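/- Let I ⊆ S = K[x_1,…,x_n] be a squarefree strongly stable monomial ideal (not necessarily generated in a single degree). Then sdepth_n(S/I) = depth(S/I); in particular the Stanley conjecture holds for S/I. -/

import Mathlib

noncomputable section

open MvPolynomial

/-- The total degree of an exponent vector. -/
def edeg {n : ℕ} (a : Fin n →₀ ℕ) : ℕ := ∑ i, a i

/-- An exponent vector is squarefree if every exponent is at most 1. -/
def IsSqfree {n : ℕ} (a : Fin n →₀ ℕ) : Prop := ∀ i, a i ≤ 1

/-- The set of exponent vectors of monomials belonging to the ideal `I`. -/
def expSet {K : Type} [Field K] {n : ℕ} (I : Ideal (MvPolynomial (Fin n) K)) :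
    Set (Fin n →₀ ℕ) := {a | (monomial a (1 : K)) ∈ I}

/-- `I` is generated by monomials `x^a` with `a` satisfying the predicate `P`. -/
def GenBy {K : Type} [Field K] {n : ℕ} (I : Ideal (MvPolynomial (Fin n) K))
    (P : (Fin n →₀ ℕ) → Prop) : Prop :=
  ∃ G : Set (Fin n →₀ ℕ), (∀ a ∈ G, P a) ∧
    I = Ideal.span ((fun a => (monomial a (1 : K))) '' G)

/-- `I` is a monomial ideal. -/
def IsMonomialIdeal {K : Type} [Field K] {n : ℕ} (I : Ideal (MvPolynomial (Fin n) K)) : Prop :=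
  GenBy I fun _ => True

/-- `I` is a squarefree monomial ideal. -/
def IsSqfreeMonomialIdeal {K : Type} [Field K] {n : ℕ}
    (I : Ideal (MvPolynomial (Fin n) K)) : Prop := GenBy I IsSqfree

/-- `x^a >_lex x^b` in the lexicographic order with `x_1 > x_2 > ⋯ > x_n`. -/
def lexGT {n : ℕ} (a b : Fin n →₀ ℕ) : Prop :=
  ∃ i : Fin n, (∀ j : Fin n, j < i → a j = b j) ∧ b i < a i

/-- `I` is a lexsegment ideal. -/
def IsLexsegment {K : Type} [Field K] {n : ℕ} (I : Ideal (MvPolynomial (Fin n) K)) : Prop :=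
  IsMonomialIdeal I ∧ ∀ a b : Fin n →₀ ℕ, (monomial a (1 : K)) ∈ I → edeg b = edeg a →
    lexGT b a → (monomial b (1 : K)) ∈ I

/-- `I` is a squarefree lexsegment ideal. -/
def IsSqfreeLexsegment {K : Type} [Field K] {n : ℕ}
    (I : Ideal (MvPolynomial (Fin n) K)) : Prop :=
  IsSqfreeMonomialIdeal I ∧ ∀ a b : Fin n →₀ ℕ, IsSqfree a → IsSqfree b →
    (monomial a (1 : K)) ∈ I → edeg b = edeg a → lexGT b a → (monomial b (1 : K)) ∈ I

/-- The minimal number of generators of an ideal. -/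
def mu {K : Type} [Field K] {n : ℕ} (I : Ideal (MvPolynomial (Fin n) K)) : ℕ :=
  sInf {m | ∃ G : Finset (MvPolynomial (Fin n) K), G.card = m ∧ I = Ideal.span (G : Set _)}

/-- `ξ_k = ∑_{j=1}^k C(2j-1, j)`. -/
def xi (k : ℕ) : ℕ := ∑ j ∈ Finset.Icc 1 k, (2 * j - 1).choose j

/-- The Hilbert function of `I`: the `K`-dimension of the degree-`j` component of `I`. -/
def hilb {K : Type} [Field K] {n : ℕ} (I : Ideal (MvPolynomial (Fin n) K)) (j : ℕ) : ℕ :=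
  Module.finrank K ↥((Submodule.restrictScalars K I) ⊓ homogeneousSubmodule (Fin n) K j)

/-- The Hilbert function of `I` extended to all integer degrees. -/
def hilbZ {K : Type} [Field K] {n : ℕ} (I : Ideal (MvPolynomial (Fin n) K)) (j : ℤ) : ℕ :=
  if 0 ≤ j then hilb I j.toNat else 0

/-- The Hilbert function of a standard graded polynomial ring in `d` variables,
at degree `t ∈ ℤ`. -/
def polyHilb (d : ℕ) (t : ℤ) : ℕ :=
  if t < 0 then 0 else if d = 0 then (if t = 0 then 1 else 0) else (t.toNat + (d - 1)).choose (d - 1)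

/-- A (standard graded) Hilbert decomposition of `I` all of whose retracts are polynomial
rings in at least `k` variables: `I ≅ ⊕ᵢ Sᵢ(-sᵢ)` as graded `K`-vector spaces, where `Sᵢ`
is a graded algebra retract of `S`, i.e. a polynomial ring in `dd i ≥ k` variables. -/
def HilbertDecomp1 {K : Type} [Field K] {n : ℕ} (I : Ideal (MvPolynomial (Fin n) K))
    (k : ℕ) : Prop :=
  ∃ (ι : Type) (_ : Fintype ι) (dd : ι → ℕ) (s : ι → ℤ),
    (∀ i, k ≤ dd i) ∧ ∀ j : ℤ, hilbZ I j = ∑ i, polyHilb (dd i) (j - s i)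

/-- The Hilbert depth of `I` in the standard graded sense. -/
def hdepth1 {K : Type} [Field K] {n : ℕ} (I : Ideal (MvPolynomial (Fin n) K)) : ℕ∞ :=
  sSup {k : ℕ∞ | ∃ m : ℕ, HilbertDecomp1 I m ∧ k = m}

/-- The set of exponent vectors `u + ℕ^Z`, corresponding to the Stanley space `x^u K[Z]`. -/
def cone {n : ℕ} (u : Fin n →₀ ℕ) (Z : Finset (Fin n)) : Set (Fin n →₀ ℕ) :=
  {a | (∀ j, u j ≤ a j) ∧ ∀ j ∉ Z, a j = u j}

/-- A Stanley decomposition, with all Stanley spaces of dimension at least `k`, of the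
`ℤⁿ`-graded module whose monomial basis has exponent set `A`. -/
def StanleyPartN {n : ℕ} (A : Set (Fin n →₀ ℕ)) (k : ℕ) : Prop :=
  ∃ (ι : Type) (_ : Fintype ι) (u : ι → (Fin n →₀ ℕ)) (Z : ι → Finset (Fin n)),
    (∀ i, k ≤ (Z i).card) ∧ (∀ i, cone (u i) (Z i) ⊆ A) ∧
    (∀ a ∈ A, ∃! i, a ∈ cone (u i) (Z i))

/-- The multigraded Stanley depth of the `ℤⁿ`-graded module whose monomial basis has
exponent set `A`. -/
def sdepthN {n : ℕ} (A : Set (Fin n →₀ ℕ)) : ℕ∞ :=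
  sSup {k : ℕ∞ | ∃ m : ℕ, StanleyPartN A m ∧ k = m}

/-- A multigraded Hilbert decomposition of the monomial ideal `I`, with all retracts
polynomial rings in at least `k` variables: the multigraded Hilbert function of `I`
(which takes values 0 and 1) equals the sum of the multigraded Hilbert functions of
the shifted retracts `x^{u i} K[Z i]`. -/
def HilbertDecompN {K : Type} [Field K] {n : ℕ} (I : Ideal (MvPolynomial (Fin n) K))
    (k : ℕ) : Prop :=
  ∃ (ι : Type) (_ : Fintype ι) (u : ι → (Fin n →₀ ℕ)) (Z : ι → Finset (Fin n)),
    (∀ i, k ≤ (Z i).card) ∧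
    (∀ a : Fin n →₀ ℕ, (a ∈ expSet I ↔ ∃ i, a ∈ cone (u i) (Z i)) ∧
      (∀ i i', a ∈ cone (u i) (Z i) → a ∈ cone (u i') (Z i') → i = i'))

/-- The multigraded Hilbert depth of a monomial ideal `I`. -/
def hdepthN {K : Type} [Field K] {n : ℕ} (I : Ideal (MvPolynomial (Fin n) K)) : ℕ∞ :=
  sSup {k : ℕ∞ | ∃ m : ℕ, HilbertDecompN I m ∧ k = m}

/-- The graded maximal ideal `(x_1, …, x_n)`. -/
def maxIdeal (K : Type) [Field K] (n : ℕ) : Ideal (MvPolynomial (Fin n) K) :=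
  Ideal.span (Set.range X)

/-- The depth of a module `M` over `S = K[x_1,…,x_n]` with respect to the graded maximal
ideal: the supremum of lengths of `M`-regular sequences in `(x_1,…,x_n)`. -/
def mdepth (K : Type) [Field K] (n : ℕ) (M : Type)
    [AddCommGroup M] [Module (MvPolynomial (Fin n) K) M] : ℕ∞ :=
  sSup {k : ℕ∞ | ∃ rs : List (MvPolynomial (Fin n) K),
    (∀ r ∈ rs, r ∈ maxIdeal K n) ∧ RingTheory.Sequence.IsRegular M rs ∧ k = rs.length}

/-- The quotient module `I/J` for ideals `J ≤ I`. -/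
def quotMod {K : Type} [Field K] {n : ℕ} (I J : Ideal (MvPolynomial (Fin n) K)) : Type :=
  ↥I ⧸ (Submodule.comap (Submodule.subtype I) J)

instance {K : Type} [Field K] {n : ℕ} (I J : Ideal (MvPolynomial (Fin n) K)) :
    AddCommGroup (quotMod I J) := by unfold quotMod; infer_instance

instance {K : Type} [Field K] {n : ℕ} (I J : Ideal (MvPolynomial (Fin n) K)) :
    Module (MvPolynomial (Fin n) K) (quotMod I J) := by unfold quotMod; infer_instance

/-- `ρ_j(I\J)`: the number of squarefree monomials of degree `j` in `I ∖ J`. -/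
def rho {K : Type} [Field K] {n : ℕ} (I J : Ideal (MvPolynomial (Fin n) K)) (j : ℕ) : ℕ :=
  Set.ncard {a : Fin n →₀ ℕ | IsSqfree a ∧ edeg a = j ∧ a ∈ expSet I ∧ a ∉ expSet J}

/-- `ρ_j(I)`: the number of squarefree monomials of degree `j` in `I`. -/
def rhoI {K : Type} [Field K] {n : ℕ} (I : Ideal (MvPolynomial (Fin n) K)) (j : ℕ) : ℕ :=
  Set.ncard {a : Fin n →₀ ℕ | IsSqfree a ∧ edeg a = j ∧ a ∈ expSet I}

/-- `I` is a stable monomial ideal. Here `j` plays the role of `m(u)`, the largest index of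
a variable dividing `u = x^a`. -/
def IsStable {K : Type} [Field K] {n : ℕ} (I : Ideal (MvPolynomial (Fin n) K)) : Prop :=
  IsMonomialIdeal I ∧ ∀ a : Fin n →₀ ℕ, (monomial a (1 : K)) ∈ I →
    ∀ j : Fin n, a j ≠ 0 → (∀ l, j < l → a l = 0) → ∀ i, i < j →
      (monomial (a + Finsupp.single i 1 - Finsupp.single j 1) (1 : K)) ∈ I

/-- `I` is a squarefree stable monomial ideal. -/
def IsSqfreeStable {K : Type} [Field K] {n : ℕ} (I : Ideal (MvPolynomial (Fin n) K)) : Prop :=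
  IsSqfreeMonomialIdeal I ∧ ∀ a : Fin n →₀ ℕ, IsSqfree a → (monomial a (1 : K)) ∈ I →
    ∀ j : Fin n, a j ≠ 0 → (∀ l, j < l → a l = 0) → ∀ i, i < j → a i = 0 →
      (monomial (a + Finsupp.single i 1 - Finsupp.single j 1) (1 : K)) ∈ I

/-- `I` is a squarefree strongly stable monomial ideal. -/
def IsSqfreeStronglyStable {K : Type} [Field K] {n : ℕ}
    (I : Ideal (MvPolynomial (Fin n) K)) : Prop :=
  IsSqfreeMonomialIdeal I ∧ ∀ a : Fin n →₀ ℕ, IsSqfree a → (monomial a (1 : K)) ∈ I →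
    ∀ i : Fin n, a i ≠ 0 → ∀ j, j < i → a j = 0 →
      (monomial (a + Finsupp.single j 1 - Finsupp.single i 1) (1 : K)) ∈ I

/-- The exponent vectors of the minimal monomial generators of a monomial ideal:
the monomials of `I` minimal with respect to divisibility. -/
def minGens {K : Type} [Field K] {n : ℕ} (I : Ideal (MvPolynomial (Fin n) K)) :
    Set (Fin n →₀ ℕ) := {a | a ∈ expSet I ∧ ∀ b ∈ expSet I, b ≤ a → b = a}

/-- `m(u)`: the largest index (1-based) of a variable dividing `x^a`; `0` if `a = 0`. -/
def mvar {n : ℕ} (a : Fin n →₀ ℕ) : ℕ := a.support.sup (fun i => (i : ℕ) + 1)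

/-- `m(I) = max { m(u) : u ∈ G(I) }`. -/
def mIdeal {K : Type} [Field K] {n : ℕ} (I : Ideal (MvPolynomial (Fin n) K)) : ℕ :=
  sSup {m | ∃ a ∈ minGens I, m = mvar a}

open MvPolynomial

/-- The `K`-subspace `Aᵢ·xᵢ` of `S`, where `Aᵢ` is the subalgebra generated by `B`. -/
def stSpace {K : Type} [Field K] {n : ℕ} (B : Finset (MvPolynomial (Fin n) K))
    (x : MvPolynomial (Fin n) K) : Submodule K (MvPolynomial (Fin n) K) :=
  (Subalgebra.toSubmodule (Algebra.adjoin K (B : Set (MvPolynomial (Fin n) K)))).map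
    (LinearMap.mulLeft K x)

/-- A standard graded Stanley decomposition of the ideal `I` with all Stanley spaces of
depth at least `k`: a finite family of graded algebra retracts `Sᵢ = K[Bᵢ]` (generated by
`k ≤ |Bᵢ|` linearly independent linear forms) and homogeneous elements `xᵢ ∈ I` with
`Sᵢ ∩ ann(xᵢ) = 0`, such that `I = ⊕ᵢ Sᵢ xᵢ` as graded `K`-vector spaces. -/
def StanleyDecomp1 {K : Type} [Field K] {n : ℕ} (I : Ideal (MvPolynomial (Fin n) K))
    (k : ℕ) : Prop :=
  ∃ (ι : Type) (_ : Fintype ι) (B : ι → Finset (MvPolynomial (Fin n) K))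
    (x : ι → MvPolynomial (Fin n) K) (d : ι → ℕ),
      (∀ i, ∀ b ∈ B i, b ∈ homogeneousSubmodule (Fin n) K 1) ∧
      (∀ i, LinearIndependent K (fun b : (B i : Set (MvPolynomial (Fin n) K)) =>
        (b : MvPolynomial (Fin n) K))) ∧
      (∀ i, k ≤ (B i).card) ∧
      (∀ i, x i ∈ I) ∧
      (∀ i, x i ∈ homogeneousSubmodule (Fin n) K (d i)) ∧
      (∀ i, ∀ a ∈ Algebra.adjoin K ((B i : Set (MvPolynomial (Fin n) K))),
        a * x i = 0 → a = 0) ∧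
      (iSup (fun i => stSpace (B i) (x i)) = Submodule.restrictScalars K I) ∧
      (iSupIndep fun i => stSpace (B i) (x i))

/-- The standard graded Stanley depth of `I`. -/
def sdepth1 {K : Type} [Field K] {n : ℕ} (I : Ideal (MvPolynomial (Fin n) K)) : ℕ∞ :=
  sSup {k : ℕ∞ | ∃ m : ℕ, StanleyDecomp1 I m ∧ k = m}

/-- The subspace `S₁ · V` of `S`. -/
def mulS1 {K : Type} [Field K] {n : ℕ} (V : Submodule K (MvPolynomial (Fin n) K)) :
    Submodule K (MvPolynomial (Fin n) K) :=
  Submodule.span K {p | ∃ l ∈ homogeneousSubmodule (Fin n) K 1, ∃ v ∈ V, p = l * v}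

/-- A lexsegment set of monomials of degree `d`. -/
def IsLexSet {n : ℕ} (d : ℕ) (L : Set (Fin n →₀ ℕ)) : Prop :=
  (∀ a ∈ L, edeg a = d) ∧ ∀ a ∈ L, ∀ b : Fin n →₀ ℕ, edeg b = d → lexGT b a → b ∈ L

/-- `V ⊆ S_d` is a Gotzmann space: `dim_K (S₁·V) = dim_K (S₁·lex(V))`, where `lex(V)` is
spanned by the lexsegment set of monomials of degree `d` of cardinality `dim_K V`. -/
def IsGotzmannSpace {K : Type} [Field K] {n : ℕ} (d : ℕ)
    (V : Submodule K (MvPolynomial (Fin n) K)) : Prop :=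
  ∃ L : Finset (Fin n →₀ ℕ), IsLexSet (n := n) d (L : Set (Fin n →₀ ℕ)) ∧ L.card = Module.finrank K ↥V ∧
    Module.finrank K ↥(mulS1 V) =
      Module.finrank K ↥(mulS1 (Submodule.span K
        ((fun a => (monomial a (1 : K))) '' (L : Set (Fin n →₀ ℕ)))))

/-- `I` is a homogeneous ideal in the standard grading. -/
def IsHomogeneousIdeal {K : Type} [Field K] {n : ℕ}
    (I : Ideal (MvPolynomial (Fin n) K)) : Prop :=
  ∀ p ∈ I, ∀ k : ℕ, homogeneousComponent k p ∈ I

/-- `I` is a Gotzmann ideal: each homogeneous component `I_k` is a Gotzmann space. -/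
def IsGotzmannIdeal {K : Type} [Field K] {n : ℕ}
    (I : Ideal (MvPolynomial (Fin n) K)) : Prop :=
  IsHomogeneousIdeal I ∧ ∀ k : ℕ,
    IsGotzmannSpace k ((Submodule.restrictScalars K I) ⊓ homogeneousSubmodule (Fin n) K k)

/-- `I` is generated by homogeneous elements of degree `d`. -/
def GenInDegHomog {K : Type} [Field K] {n : ℕ} (I : Ideal (MvPolynomial (Fin n) K))
    (d : ℕ) : Prop :=
  ∃ G : Set (MvPolynomial (Fin n) K), (∀ g ∈ G, g ∈ homogeneousSubmodule (Fin n) K d) ∧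
    I = Ideal.span G

theorem exists_pow_add_mem_and_smul_eq_zero {R N : Type*} [CommRing R] [AddCommGroup N]
    [Module R N] [Module.Finite R N] {s x : R}
    (h : ∀ y : N, ∃ z : N, s • y = x • z) :
    ∃ (k : ℕ) (a : R), ∀ y : N, (s ^ k + x * a) • y = 0 := by
  obtain ⟨p, hp, -, hc, h0⟩ :=
    LinearMap.exists_monic_and_natDegree_eq_and_coeff_mem_pow_and_aeval_eq_zero R
      (algebraMap R (Module.End R N) s) (Ideal.span {x}) (by
        rintro _ ⟨y, rfl⟩
        obtain ⟨z, hz⟩ := h y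
        rw [Module.algebraMap_end_apply, hz]
        exact Submodule.smul_mem_smul (Ideal.mem_span_singleton_self x) trivial)
  rw [Polynomial.aeval_algebraMap_apply] at h0
  have hd : x ∣ p.eval s - s ^ p.natDegree := by
    rw [Polynomial.eval_eq_sum_range, Finset.sum_range_succ, hp.coeff_natDegree, one_mul,
      add_sub_cancel_right]
    refine Finset.dvd_sum fun i hi ↦ Dvd.dvd.mul_right ?_ _
    have hi' : p.natDegree - i ≠ 0 := by have := Finset.mem_range.1 hi; omega
    exact Ideal.mem_span_singleton.1 (Ideal.pow_le_self hi' (hc i))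
  obtain ⟨a, ha⟩ := hd
  refine ⟨p.natDegree, a, fun y ↦ ?_⟩
  rw [← ha, add_sub_cancel]
  simpa using LinearMap.congr_fun h0 y

open scoped Pointwise in
theorem IsSMulRegular.exists_isAssociatedPrime_quotSMulTop {R M : Type*} [CommRing R]
    [IsNoetherianRing R] [AddCommGroup M] [Module R M] [Module.Finite R M] {x : R}
    (hx : IsSMulRegular M x) {m p : Ideal R} [m.IsPrime] (hxm : x ∈ m)
    (hp : IsAssociatedPrime p M) (hpm : p ≤ m) :
    ∃ q : Ideal R, IsAssociatedPrime q (QuotSMulTop x M) ∧ q ≤ m ∧ p ≤ q ∧ x ∈ q ∧ x ∉ p := by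
  obtain ⟨hp', u, hu⟩ := isAssociatedPrime_iff.1 hp
  have hu' : ∀ r, r ∈ p ↔ r • u = 0 := fun r ↦ by
    rw [hu, Submodule.mem_colon_singleton, Submodule.mem_bot]
  let N := Submodule.torsionBySet R M (p : Set R)
  have hN : ∀ y, y ∈ N ↔ ∀ r ∈ p, r • y = 0 := fun y ↦ by
    simp [N, Submodule.mem_torsionBySet_iff]
  let Q := N.map (x • (⊤ : Submodule R M)).mkQ
  have hQ : Module.annihilator R Q ≤ m := by
    intro s hs
    by_contra hsm
    have key : ∀ y : N, ∃ z : N, s • y = x • z := by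
      rintro ⟨y, hy⟩
      have h1 : s • (x • (⊤ : Submodule R M)).mkQ y = 0 :=
        (Submodule.mem_annihilator.1 hs) _ (Submodule.mem_map_of_mem hy)
      rw [← map_smul, Submodule.mkQ_apply, Submodule.Quotient.mk_eq_zero,
        Submodule.mem_smul_pointwise_iff_exists] at h1
      obtain ⟨z, -, hz⟩ := h1
      refine ⟨⟨z, (hN z).2 fun r hr ↦ hx ?_⟩, Subtype.ext hz.symm⟩
      change x • r • z = x • 0
      rw [smul_comm, hz, smul_comm, (hN y).1 hy r hr, smul_zero, smul_zero]
    obtain ⟨k, a, h⟩ := exists_pow_add_mem_and_smul_eq_zero key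
    have hmem : s ^ k + x * a ∈ m := hpm <| (hu' _).2 <|
      congrArg Subtype.val (h ⟨u, (hN u).2 fun r hr ↦ (hu' r).1 hr⟩)
    exact hsm (Ideal.IsPrime.mem_of_pow_mem ‹_› k
      ((Ideal.add_mem_iff_left m (Ideal.mul_mem_right a m hxm)).1 hmem))
  obtain ⟨q, hq, hqm⟩ := Ideal.exists_minimalPrimes_le hQ
  refine ⟨q, ?_, hqm, fun r hr ↦ hq.1.2 ?_, hq.1.2 ?_, fun hxp ↦ ?_⟩
  · exact associatedPrimes.subset_of_injective Q.injective_subtype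
      (Module.associatedPrimes.minimalPrimes_annihilator_subset_associatedPrimes R Q hq)
  · refine Submodule.mem_annihilator.2 ?_
    rintro _ ⟨y, hy, rfl⟩
    rw [← map_smul, (hN y).1 hy r hr, map_zero]
  · refine Submodule.mem_annihilator.2 ?_
    rintro _ ⟨y, hy, rfl⟩
    rw [← map_smul, Submodule.mkQ_apply, Submodule.Quotient.mk_eq_zero]
    exact Submodule.smul_mem_pointwise_smul _ _ _ trivial
  · have h0 : u = 0 := hx (by simpa using (hu' x).1 hxp)
    exact hp'.ne_top ((Ideal.eq_top_iff_one _).2 ((hu' 1).2 (by rw [h0, smul_zero])))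

/-- The length of a regular sequence in a prime `m` is at most `dim R / p` for each
associated prime `p` contained in `m`. -/
theorem RingTheory.Sequence.IsWeaklyRegular.length_le_ringKrullDim_quotient {R : Type*}
    [CommRing R] [IsNoetherianRing R] {m : Ideal R} [m.IsPrime] (rs : List R) {M : Type*}
    [AddCommGroup M] [Module R M] [Module.Finite R M] (hrs : ∀ r ∈ rs, r ∈ m)
    (h : RingTheory.Sequence.IsWeaklyRegular M rs) {p : Ideal R}
    (hp : IsAssociatedPrime p M) (hpm : p ≤ m) :
    (rs.length : WithBot ℕ∞) ≤ ringKrullDim (R ⧸ p) := by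
  induction rs generalizing M p with
  | nil =>
    have := hp.isPrime
    simpa using ringKrullDim_nonneg_of_nontrivial
  | cons x rs ih =>
    rw [RingTheory.Sequence.isWeaklyRegular_cons_iff] at h
    obtain ⟨q, hq, hqm, hpq, hxq, hxp⟩ :=
      h.1.exists_isAssociatedPrime_quotSMulTop (hrs x List.mem_cons_self) hp hpm
    have := hp.isPrime
    have h1 := ih (fun r hr ↦ hrs r (List.mem_cons_of_mem _ hr)) h.2 hq hqm
    have h2 : ringKrullDim (R ⧸ q) + 1 ≤ ringKrullDim (R ⧸ p) :=
      ringKrullDim_succ_le_of_surjective (Ideal.Quotient.factor hpq)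
        (Ideal.Quotient.factor_surjective hpq) (r := Ideal.Quotient.mk p x)
        (mem_nonZeroDivisors_of_ne_zero (by rwa [Ne, Ideal.Quotient.eq_zero_iff_mem]))
        (by rwa [Ideal.Quotient.factor_mk, Ideal.Quotient.eq_zero_iff_mem])
    refine le_trans ?_ h2
    rw [List.length_cons, Nat.cast_add, Nat.cast_one]
    gcongr


section FaceIdeal

variable {K σ : Type} [Field K] [DecidableEq σ]

/-- The Stanley–Reisner ideal of the complex `Γ`: polynomials none of whose monomials is
supported on a face of `Γ`. -/
def faceIdeal (K : Type) [Field K] {σ : Type} [DecidableEq σ] (Γ : LowerSet (Finset σ)) :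
    Ideal (MvPolynomial σ K) where
  carrier := {f | ∀ a ∈ f.support, a.support ∉ Γ}
  zero_mem' := by simp
  add_mem' {f g} hf hg a ha :=
    (Finset.mem_union.1 (support_add ha)).elim (hf a) (hg a)
  smul_mem' c f hf a ha haΓ := by
    obtain ⟨b, -, e, he, rfl⟩ := Finset.mem_add.1 (support_mul c f ha)
    exact hf e he (Γ.lower (Finsupp.support_mono (self_le_add_left e b)) haΓ)

theorem mem_faceIdeal {Γ : LowerSet (Finset σ)} {f : MvPolynomial σ K} :
    f ∈ faceIdeal K Γ ↔ ∀ a ∈ f.support, a.support ∉ Γ := Iff.rfl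

theorem monomial_mem_faceIdeal {Γ : LowerSet (Finset σ)} {a : σ →₀ ℕ} :
    monomial a (1 : K) ∈ faceIdeal K Γ ↔ a.support ∉ Γ := by
  classical
  simp [mem_faceIdeal, support_monomial]

theorem faceIdeal_anti {Γ Γ' : LowerSet (Finset σ)} (h : Γ ≤ Γ') :
    faceIdeal K Γ' ≤ faceIdeal K Γ := fun _ hf a ha haΓ ↦ hf a ha (h haΓ)

theorem faceIdeal_bot : faceIdeal K (⊥ : LowerSet (Finset σ)) = ⊤ :=
  eq_top_iff.2 fun _ _ _ _ h ↦ h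

/-- The faces `G` with `insert v G ∈ Γ`. -/
def LowerSet.faceStar (Γ : LowerSet (Finset σ)) (v : σ) : LowerSet (Finset σ) where
  carrier := {G | insert v G ∈ Γ}
  lower' _ _ h hG := Γ.lower (Finset.insert_subset_insert v h) hG

/-- The faces of `Γ` that do not contain `v`. -/
def LowerSet.faceDel (Γ : LowerSet (Finset σ)) (v : σ) : LowerSet (Finset σ) where
  carrier := {G | G ∈ Γ ∧ v ∉ G}
  lower' _ _ h hG := ⟨Γ.lower h hG.1, fun hv ↦ hG.2 (h hv)⟩

theorem LowerSet.mem_faceStar {Γ : LowerSet (Finset σ)} {v : σ} {G : Finset σ} :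
    G ∈ Γ.faceStar v ↔ insert v G ∈ Γ := Iff.rfl

theorem LowerSet.faceDel_le {τ : Type} (Γ : LowerSet (Finset τ)) (v : τ) : Γ.faceDel v ≤ Γ :=
  fun G (h : G ∈ Γ ∧ v ∉ G) ↦ h.1

theorem support_single_add_eq_insert (v : σ) (a : σ →₀ ℕ) :
    (Finsupp.single v 1 + a).support = insert v a.support := by
  ext j
  by_cases h : j = v <;> simp [h, eq_comm]

theorem X_mul_mem_faceIdeal {Γ : LowerSet (Finset σ)} {v : σ} {f : MvPolynomial σ K} :
    X v * f ∈ faceIdeal K Γ ↔ f ∈ faceIdeal K (Γ.faceStar v) := by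
  simp only [mem_faceIdeal, support_X_mul, Finset.mem_map, forall_exists_index, and_imp,
    forall_apply_eq_imp_iff₂, addLeftEmbedding_apply, support_single_add_eq_insert,
    LowerSet.mem_faceStar]

theorem exists_sub_X_mul_mem_faceIdeal {Γ : LowerSet (Finset σ)} {v : σ}
    {f : MvPolynomial σ K} (hf : f ∈ faceIdeal K (Γ.faceDel v)) :
    ∃ g, f - X v * g ∈ faceIdeal K Γ := by
  refine ⟨f.divMonomial (Finsupp.single v 1), ?_⟩
  have h := divMonomial_add_modMonomial_single f v
  rw [← eq_sub_iff_add_eq'] at h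
  rw [← h]
  intro a ha haΓ
  rw [mem_support_iff] at ha
  by_cases hav : Finsupp.single v 1 ≤ a
  · exact ha (coeff_modMonomial_of_le _ hav)
  · rw [coeff_modMonomial_of_not_le _ hav] at ha
    refine hf a (mem_support_iff.2 ha) ⟨haΓ, fun hv ↦ hav ?_⟩
    rw [Finsupp.single_le_iff]
    exact Nat.one_le_iff_ne_zero.2 (Finsupp.mem_support_iff.1 hv)

theorem X_mem_faceIdeal_faceDel (Γ : LowerSet (Finset σ)) (v : σ) :
    (X v : MvPolynomial σ K) ∈ faceIdeal K (Γ.faceDel v) :=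
  monomial_mem_faceIdeal.2 fun h ↦ h.2 (by simp)

theorem faceIdeal_Iic_eq_ker (F : Finset σ) :
    faceIdeal K (LowerSet.Iic F) =
      RingHom.ker (killCompl (R := K) (Subtype.val_injective (p := (· ∈ F)))) := by
  ext f
  rw [RingHom.mem_ker]
  constructor
  · intro hf
    rw [f.as_sum, map_sum]
    refine Finset.sum_eq_zero fun a ha ↦ ?_
    refine killCompl_monomial_eq_zero_of_not_subset _ _ fun h ↦ hf a ha ?_
    simpa [Set.subset_def, Finset.subset_iff] using h
  · intro hf a ha haF
    have hr : (a.support : Set σ) ⊆ Set.range (Subtype.val : F → σ) := by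
      simpa [Set.subset_def, Finset.subset_iff] using haF
    have h := congrArg (coeff (a.comapDomain _ Subtype.val_injective.injOn)) hf
    rw [coeff_killCompl, Finsupp.mapDomain_comapDomain _ Subtype.val_injective _ hr,
      coeff_zero] at h
    exact mem_support_iff.1 ha h

theorem killCompl_surjective {ρ τ : Type} {f : τ → ρ} (hf : Function.Injective f) :
    Function.Surjective (killCompl (R := K) hf) :=
  fun p ↦ ⟨rename f p, killCompl_rename_app hf p⟩

instance isPrime_faceIdeal_Iic (F : Finset σ) : (faceIdeal K (LowerSet.Iic F)).IsPrime := by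
  rw [faceIdeal_Iic_eq_ker]
  exact RingHom.ker_isPrime _

theorem ringKrullDim_quotient_faceIdeal_Iic (F : Finset σ) :
    ringKrullDim (MvPolynomial σ K ⧸ faceIdeal K (LowerSet.Iic F)) = F.card := by
  rw [faceIdeal_Iic_eq_ker]
  refine (ringKrullDim_eq_of_ringEquiv (RingHom.quotientKerEquivOfSurjective
    (killCompl_surjective (K := K) (Subtype.val_injective (p := (· ∈ F)))))).trans ?_
  rw [MvPolynomial.ringKrullDim_of_isNoetherianRing, ringKrullDim_eq_zero_of_field]
  simp

/-- The exponent vector of the squarefree monomial with support `F`. -/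
def sqfreeExp (F : Finset σ) : σ →₀ ℕ := Finsupp.indicator F fun _ _ ↦ 1

theorem sqfreeExp_apply (F : Finset σ) (j : σ) : sqfreeExp F j = if j ∈ F then 1 else 0 := by
  simp [sqfreeExp, Finsupp.indicator_apply]

theorem support_sqfreeExp (F : Finset σ) : (sqfreeExp F).support = F := by
  ext j; simp [sqfreeExp_apply]

theorem monomial_mul_mem_faceIdeal {Γ : LowerSet (Finset σ)} {e : σ →₀ ℕ}
    {f : MvPolynomial σ K} :
    monomial e 1 * f ∈ faceIdeal K Γ ↔ ∀ a ∈ f.support, e.support ∪ a.support ∉ Γ := by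
  have hs : ∀ a : σ →₀ ℕ, (e + a).support = e.support ∪ a.support := fun a ↦ by
    ext j; simp [or_iff_not_and_not]
  refine ⟨fun h a ha ↦ ?_, fun h a ha haΓ ↦ ?_⟩
  · rw [← hs]
    refine h _ (mem_support_iff.2 ?_)
    rwa [coeff_monomial_mul, one_mul, ← mem_support_iff]
  · rw [mem_support_iff, coeff_monomial_mul'] at ha
    split_ifs at ha with hle
    · rw [one_mul, ← mem_support_iff] at ha
      refine h _ ha ?_
      rwa [← hs, add_tsub_cancel_of_le hle]
    · exact ha rfl

/-- Facets give associated primes. -/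
theorem isAssociatedPrime_faceIdeal_Iic [Finite σ] {Γ : LowerSet (Finset σ)} {F : Finset σ}
    (hF : Maximal (· ∈ Γ) F) :
    IsAssociatedPrime (faceIdeal K (LowerSet.Iic F)) (MvPolynomial σ K ⧸ faceIdeal K Γ) := by
  refine isAssociatedPrime_iff.2 ⟨inferInstance,
    Ideal.Quotient.mk _ (monomial (sqfreeExp F) 1), ?_⟩
  ext f
  rw [Submodule.mem_colon_singleton, Submodule.mem_bot]
  change _ ↔ Ideal.Quotient.mk _ (f * monomial (sqfreeExp F) 1) = 0
  rw [Ideal.Quotient.eq_zero_iff_mem, mul_comm, monomial_mul_mem_faceIdeal, mem_faceIdeal]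
  refine forall₂_congr fun a _ ↦ not_congr ?_
  rw [support_sqfreeExp, LowerSet.mem_Iic_iff]
  exact ⟨fun h ↦ (Finset.union_eq_left.2 h).symm ▸ hF.prop,
    fun h ↦ (Finset.union_subset_iff.1 (hF.2 h Finset.subset_union_left)).2⟩

end FaceIdeal

section Ext

open CategoryTheory CategoryTheory.Abelian

theorem CategoryTheory.ShortComplex.ShortExact.subsingleton_ext {C : Type*} [Category C]
    [Abelian C] [HasExt C] {S : ShortComplex C} (hS : S.ShortExact) (X : C) (k : ℕ)
    (h₁ : Subsingleton (Ext X S.X₁ k)) (h₃ : Subsingleton (Ext X S.X₃ k)) :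
    Subsingleton (Ext X S.X₂ k) := by
  refine subsingleton_of_forall_eq 0 fun y ↦ ?_
  obtain ⟨z, rfl⟩ := Ext.covariant_sequence_exact₂ X hS y (Subsingleton.elim _ _)
  rw [Subsingleton.elim z 0, Ext.zero_comp]

theorem Ideal.subsingleton_ext_quotient {R : Type} [CommRing R] {x : R} {I J L : Ideal R}
    (hI : ∀ f, x * f ∈ J ↔ f ∈ I) (hJL : J ≤ L) (hx : x ∈ L)
    (hL : ∀ f ∈ L, ∃ g, f - x * g ∈ J) (N : ModuleCat.{0} R) (k : ℕ)
    (h₁ : Subsingleton (Ext N (ModuleCat.of R (R ⧸ I)) k))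
    (h₃ : Subsingleton (Ext N (ModuleCat.of R (R ⧸ L)) k)) :
    Subsingleton (Ext N (ModuleCat.of R (R ⧸ J)) k) := by
  let f : R ⧸ I →ₗ[R] R ⧸ J := Submodule.mapQ I J (LinearMap.mulLeft R x) fun a ha ↦ (hI a).2 ha
  let g : R ⧸ J →ₗ[R] R ⧸ L := Submodule.factor hJL
  have hfg : Function.Exact f g := by
    intro y
    obtain ⟨y, rfl⟩ := Submodule.Quotient.mk_surjective _ y
    change (Submodule.Quotient.mk y : R ⧸ L) = 0 ↔ _
    rw [Submodule.Quotient.mk_eq_zero]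
    constructor
    · intro hy
      obtain ⟨z, hz⟩ := hL y hy
      exact ⟨Submodule.Quotient.mk z, ((Submodule.Quotient.eq J).2 hz).symm⟩
    · rintro ⟨z, hz⟩
      obtain ⟨z, rfl⟩ := Submodule.Quotient.mk_surjective _ z
      have hz' : x * z - y ∈ J := (Submodule.Quotient.eq J).1 hz
      exact (Submodule.sub_mem_iff_right L (L.mul_mem_right z hx)).1 (hJL hz')
  have hf : Function.Injective f := by
    rw [← LinearMap.ker_eq_bot, LinearMap.ker_eq_bot']
    intro y hy
    obtain ⟨y, rfl⟩ := Submodule.Quotient.mk_surjective _ y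
    exact (Submodule.Quotient.mk_eq_zero _).2
      ((hI y).1 ((Submodule.Quotient.mk_eq_zero J).1 hy))
  let S := ModuleCat.shortComplexOfCompEqZero f g hfg.linearMap_comp_eq_zero
  have hS : S.ShortExact :=
    ModuleCat.shortComplex_shortExact S hfg hf (Submodule.factor_surjective hJL)
  exact hS.subsingleton_ext N k h₁ h₃

end Ext

theorem Ideal.smul_top_quotient_lt_top {R : Type*} [CommRing R] {I J : Ideal R} (hJI : J ≤ I)
    (hI : I ≠ ⊤) : I • (⊤ : Submodule R (R ⧸ J)) < ⊤ := by
  rw [lt_top_iff_ne_top, Ne, Ideal.smul_top_eq_map, Submodule.restrictScalars_eq_top_iff,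
    Ideal.Quotient.algebraMap_eq, Ideal.eq_top_iff_one, ← map_one (Ideal.Quotient.mk J),
    Ideal.mem_quotient_iff_mem hJI]
  exact (Ideal.ne_top_iff_one I).1 hI

section Depth

open CategoryTheory CategoryTheory.Abelian

variable {K σ : Type} [Field K] [DecidableEq σ]

theorem LowerSet.faceStar_Iic {v : σ} {F : Finset σ} (hv : v ∈ F) :
    (LowerSet.Iic F).faceStar v = LowerSet.Iic F := by
  ext G
  simp [LowerSet.faceStar, Finset.insert_subset_iff, hv]

theorem LowerSet.faceDel_Iic_insert {v : σ} {F : Finset σ} (hv : v ∉ F) :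
    (LowerSet.Iic (insert v F)).faceDel v = LowerSet.Iic F := by
  ext G
  simp only [LowerSet.faceDel]
  constructor
  · rintro ⟨h, hvG⟩
    exact (Finset.subset_insert_iff_of_notMem hvG).1 h
  · intro h
    exact ⟨h.trans (Finset.subset_insert _ _), fun hvG ↦ hv (h hvG)⟩

open scoped Pointwise in
theorem exists_isRegular_quotient_faceIdeal_Iic (F : Finset σ) :
    ∃ rs : List (MvPolynomial σ K), rs.length = F.card ∧
      (∀ r ∈ rs, r ∈ faceIdeal K (LowerSet.Iic ∅)) ∧
      RingTheory.Sequence.IsRegular (MvPolynomial σ K ⧸ faceIdeal K (LowerSet.Iic F)) rs := by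
  induction F using Finset.induction_on with
  | empty =>
    exact ⟨[], rfl, by simp, .nil _ _⟩
  | insert v F hv ih =>
    obtain ⟨rs, hlen, hmem, hreg⟩ := ih
    have hle : faceIdeal K (LowerSet.Iic (insert v F)) ≤ faceIdeal K (LowerSet.Iic F) :=
      faceIdeal_anti (LowerSet.Iic_le.2 (Finset.subset_insert v F))
    have hdel := LowerSet.faceDel_Iic_insert hv
    refine ⟨X v :: rs, by simp [hlen, hv], ?_, ?_⟩
    · rintro r hr
      rcases List.mem_cons.1 hr with rfl | hr
      · exact monomial_mem_faceIdeal.2 fun h ↦ by simp at h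
      · exact hmem r hr
    · refine (RingTheory.Sequence.isRegular_cons_iff _ _ _).2 ⟨?_, ?_⟩
      · refine (isSMulRegular_iff_right_eq_zero_of_smul).2 fun y hy ↦ ?_
        obtain ⟨y, rfl⟩ := Ideal.Quotient.mk_surjective y
        have hy' : X v * y ∈ faceIdeal K (LowerSet.Iic (insert v F)) :=
          Ideal.Quotient.eq_zero_iff_mem.1 hy
        rw [X_mul_mem_faceIdeal, LowerSet.faceStar_Iic (Finset.mem_insert_self v F)] at hy'
        exact Ideal.Quotient.eq_zero_iff_mem.2 hy'
      · let φ := Submodule.factor hle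
        have hφ : (X v : MvPolynomial σ K) • (⊤ : Submodule (MvPolynomial σ K)
            (MvPolynomial σ K ⧸ faceIdeal K (LowerSet.Iic (insert v F)))) = LinearMap.ker φ := by
          ext y
          obtain ⟨y, rfl⟩ := Ideal.Quotient.mk_surjective y
          rw [LinearMap.mem_ker, Submodule.mem_smul_pointwise_iff_exists]
          change _ ↔ Ideal.Quotient.mk _ y = 0
          rw [Ideal.Quotient.eq_zero_iff_mem]
          constructor
          · rintro ⟨z, -, hz⟩
            obtain ⟨z, rfl⟩ := Ideal.Quotient.mk_surjective z
            have hz' := hle (Ideal.Quotient.eq.1 hz)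
            refine (Submodule.sub_mem_iff_right _ (Ideal.mul_mem_right z _ ?_)).1 hz'
            exact hdel ▸ X_mem_faceIdeal_faceDel _ v
          · intro hy
            rw [← hdel] at hy
            obtain ⟨g, hg⟩ := exists_sub_X_mul_mem_faceIdeal hy
            exact ⟨Ideal.Quotient.mk _ g, trivial, (Ideal.Quotient.eq.2 hg).symm⟩
        let e := (Submodule.quotEquivOfEq _ _ hφ).trans
          (φ.quotKerEquivOfSurjective (Submodule.factor_surjective hle))
        exact (e.isRegular_congr rs).2 hreg

theorem subsingleton_ext_quotient_faceIdeal_Iic [Finite σ] (F : Finset σ) (k : ℕ)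
    (hk : k < F.card) :
    Subsingleton (Ext (ModuleCat.of (MvPolynomial σ K)
      (MvPolynomial σ K ⧸ faceIdeal K (LowerSet.Iic ∅)))
      (ModuleCat.of _ (MvPolynomial σ K ⧸ faceIdeal K (LowerSet.Iic F))) k) := by
  obtain ⟨rs, hlen, hmem, hreg⟩ := exists_isRegular_quotient_faceIdeal_Iic (K := K) F
  refine ModuleCat.subsingleton_ext_of_exists_isRegular (faceIdeal K (LowerSet.Iic ∅)) _ ?_ _
    (Ideal.smul_top_quotient_lt_top (faceIdeal_anti (LowerSet.Iic_le.2 ?_))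
      (Ideal.IsPrime.ne_top inferInstance)) rs hmem hreg k (hlen ▸ hk)
  · rw [Module.support_eq_zeroLocus, Ideal.annihilator_quotient]
  · exact Finset.empty_subset F

theorem exists_isRegular_of_subsingleton_ext [Finite σ] {Γ : LowerSet (Finset σ)} (hΓ : ∅ ∈ Γ)
    (d : ℕ)
    (h : ∀ k < d, Subsingleton (Ext (ModuleCat.of (MvPolynomial σ K)
      (MvPolynomial σ K ⧸ faceIdeal K (LowerSet.Iic ∅)))
      (ModuleCat.of _ (MvPolynomial σ K ⧸ faceIdeal K Γ)) k)) :
    ∃ rs : List (MvPolynomial σ K), rs.length = d ∧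
      (∀ r ∈ rs, r ∈ faceIdeal K (LowerSet.Iic ∅)) ∧
      RingTheory.Sequence.IsRegular (MvPolynomial σ K ⧸ faceIdeal K Γ) rs := by
  refine ModuleCat.exists_isRegular_of_exists_subsingleton_ext (faceIdeal K (LowerSet.Iic ∅)) d
    (ModuleCat.of _ (MvPolynomial σ K ⧸ faceIdeal K Γ))
    (Ideal.smul_top_quotient_lt_top (faceIdeal_anti (LowerSet.Iic_le.2 hΓ))
      (Ideal.IsPrime.ne_top inferInstance)) _ ?_ h
  rw [Module.support_eq_zeroLocus, Ideal.annihilator_quotient]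

theorem subsingleton_ext_faceIdeal_of_star_of_del {Γ : LowerSet (Finset σ)} (v : σ)
    (N : ModuleCat.{0} (MvPolynomial σ K)) (k : ℕ)
    (h₁ : Subsingleton (Ext N (ModuleCat.of _ (MvPolynomial σ K ⧸ faceIdeal K (Γ.faceStar v))) k))
    (h₃ : Subsingleton (Ext N (ModuleCat.of _ (MvPolynomial σ K ⧸ faceIdeal K (Γ.faceDel v))) k)) :
    Subsingleton (Ext N (ModuleCat.of _ (MvPolynomial σ K ⧸ faceIdeal K Γ)) k) :=
  Ideal.subsingleton_ext_quotient (x := X v) (fun _ ↦ X_mul_mem_faceIdeal)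
    (faceIdeal_anti (LowerSet.faceDel_le Γ v)) (X_mem_faceIdeal_faceDel Γ v)
    (fun _ ↦ exists_sub_X_mul_mem_faceIdeal) N k h₁ h₃

theorem subsingleton_ext_faceIdeal_bot (N : ModuleCat.{0} (MvPolynomial σ K)) (k : ℕ) :
    Subsingleton (Ext N
      (ModuleCat.of _ (MvPolynomial σ K ⧸ faceIdeal K (⊥ : LowerSet (Finset σ)))) k) := by
  have : Subsingleton (MvPolynomial σ K ⧸ faceIdeal K (⊥ : LowerSet (Finset σ))) :=
    Ideal.Quotient.subsingleton_iff.2 faceIdeal_bot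
  refine subsingleton_of_forall_eq 0 fun y ↦ ?_
  rw [← y.comp_mk₀_id, (ModuleCat.isZero_of_subsingleton _).eq_of_src (𝟙 _) 0, Ext.mk₀_zero,
    Ext.comp_zero]

end Depth

section Shifted

/-- A complex on `Fin n` is shifted if it is closed under replacing a vertex of a face by a
larger one. -/
def IsShifted {n : ℕ} (Γ : LowerSet (Finset (Fin n))) : Prop :=
  ∀ G ∈ Γ, ∀ x ∈ G, ∀ w ∉ G, x < w → insert w (G.erase x) ∈ Γ

variable {n : ℕ} {Γ : LowerSet (Finset (Fin n))} {i : ℕ} {P : Finset (Fin n)}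

/-- The union of `P` with all vertices from position `i` on. -/
def withTail (i : ℕ) (P : Finset (Fin n)) : Finset (Fin n) := {x | x ∈ P ∨ i ≤ (x : ℕ)}

theorem mem_withTail {x : Fin n} : x ∈ withTail i P ↔ x ∈ P ∨ i ≤ (x : ℕ) := by
  simp [withTail]

theorem withTail_of_le (h : n ≤ i) : withTail i P = P := by
  ext x
  simp only [mem_withTail, or_iff_left_iff_imp]
  omega

theorem withTail_insert {v : Fin n} (h : i ≤ v) : withTail i (insert v P) = withTail i P := by
  ext x
  simp only [mem_withTail, Finset.mem_insert]
  grind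

theorem IsShifted.maximal_withTail (hΓ : IsShifted Γ) (h : withTail i P ∈ Γ)
    (hmin : ∀ j < i, withTail j P ∉ Γ) :
    Maximal (· ∈ Γ) (withTail i P) := by
  refine ⟨h, fun H hH hle x hx ↦ ?_⟩
  by_contra hxF
  have hx' : x ∉ P ∧ (x : ℕ) < i := by simpa [mem_withTail] using hxF
  have hxn := x.2
  obtain ⟨w, hw⟩ : ∃ w : ℕ, w + 1 = i := ⟨i - 1, by omega⟩
  have hins : insert x (withTail i P) ∈ Γ := Γ.lower (Finset.insert_subset hx hle) hH
  have key : ∀ y : Fin n, (y : ℕ) = w → insert y (withTail i P) ∉ Γ := by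
    intro y hy hmem
    refine hmin w (by omega) (Γ.lower ?_ hmem)
    intro z hz
    rw [mem_withTail] at hz
    rw [Finset.mem_insert, mem_withTail, Fin.ext_iff]
    grind
  by_cases hin : i ≤ n
  · have hwn : w < n := by omega
    by_cases hxw : (x : ℕ) = w
    · exact key x hxw hins
    · refine key ⟨w, hwn⟩ rfl ?_
      by_cases hwP : (⟨w, hwn⟩ : Fin n) ∈ withTail i P
      · rwa [Finset.insert_eq_of_mem hwP]
      · have := hΓ _ hins x (Finset.mem_insert_self _ _) ⟨w, hwn⟩
          (by simp [hwP, Fin.ext_iff, Ne.symm hxw]) (Fin.lt_def.2 (by simp; omega))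
        rwa [Finset.erase_insert hxF] at this
  · refine hmin n (by omega) ?_
    rwa [withTail_of_le le_rfl, ← withTail_of_le (i := i) (P := P) (by omega)]

/-- The subcomplex of faces whose vertices before position `i` lie in `P`, and
whose union with `P` is a face. -/
def LowerSet.initialPart (Γ : LowerSet (Finset (Fin n))) (i : ℕ) (P : Finset (Fin n)) :
    LowerSet (Finset (Fin n)) where
  carrier := {G | (∀ j ∈ G, (j : ℕ) < i → j ∈ P) ∧ G ∪ P ∈ Γ}
  lower' _ _ h hG := ⟨fun j hj ↦ hG.1 j (h hj), Γ.lower (Finset.union_subset_union_left h) hG.2⟩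

theorem LowerSet.mem_initialPart {G : Finset (Fin n)} :
    G ∈ Γ.initialPart i P ↔ (∀ j ∈ G, (j : ℕ) < i → j ∈ P) ∧ G ∪ P ∈ Γ := Iff.rfl

theorem LowerSet.initialPart_zero_empty : Γ.initialPart 0 ∅ = Γ := by
  ext G
  change G ∈ Γ.initialPart 0 ∅ ↔ G ∈ Γ
  simp [LowerSet.mem_initialPart]

theorem LowerSet.initialPart_eq_bot (hP : P ∉ Γ) : Γ.initialPart i P = ⊥ :=
  eq_bot_iff.2 fun _ h ↦ hP (Γ.lower Finset.subset_union_right h.2)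

theorem LowerSet.initialPart_eq_Iic (h : withTail i P ∈ Γ) :
    Γ.initialPart i P = LowerSet.Iic (withTail i P) := by
  ext G
  constructor
  · intro hG x hx
    rw [mem_withTail]
    by_contra! hx'
    exact hx'.1 (hG.1 x hx hx'.2)
  · intro hG
    have hG' : G ⊆ withTail i P := hG
    refine ⟨fun j hj hji ↦ ?_, Γ.lower (Finset.union_subset hG' fun x hx ↦ ?_) h⟩
    · exact (mem_withTail.1 (hG' hj)).resolve_right (by omega)
    · exact mem_withTail.2 (Or.inl hx)

theorem LowerSet.faceStar_initialPart {v : Fin n} :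
    (Γ.initialPart v P).faceStar v = Γ.initialPart (v + 1) (insert v P) := by
  ext G
  change ((∀ j ∈ insert v G, (j : ℕ) < v → j ∈ P) ∧ insert v G ∪ P ∈ Γ) ↔
    ((∀ j ∈ G, (j : ℕ) < v + 1 → j ∈ insert v P) ∧ G ∪ insert v P ∈ Γ)
  rw [Finset.insert_union, Finset.union_insert]
  refine and_congr_left fun _ ↦ ⟨fun h j hj hjv ↦ ?_, fun h j hj hjv ↦ ?_⟩
  · rw [Finset.mem_insert, Fin.ext_iff]
    grind
  · have := h j
    grind

theorem LowerSet.faceDel_initialPart {v : Fin n} (hP : ∀ x ∈ P, x < v) :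
    (Γ.initialPart v P).faceDel v = Γ.initialPart (v + 1) P := by
  ext G
  change (((∀ j ∈ G, (j : ℕ) < v → j ∈ P) ∧ G ∪ P ∈ Γ) ∧ v ∉ G) ↔
    ((∀ j ∈ G, (j : ℕ) < v + 1 → j ∈ P) ∧ G ∪ P ∈ Γ)
  constructor
  · rintro ⟨⟨h, hG⟩, hv⟩
    refine ⟨fun j hj hjv ↦ h j hj ?_, hG⟩
    have : j ≠ v := fun e ↦ hv (e ▸ hj)
    rw [Ne, Fin.ext_iff] at this
    omega
  · rintro ⟨h, hG⟩
    exact ⟨⟨fun j hj hjv ↦ h j hj (by omega), hG⟩, fun hv ↦ lt_irrefl v (hP v (h v hv (by omega)))⟩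

open CategoryTheory.Abelian in
theorem IsShifted.subsingleton_ext_initialPart {K : Type} [Field K] (hΓ : IsShifted Γ) {d : ℕ}
    (hd : ∀ F, Maximal (· ∈ Γ) F → d ≤ F.card) (i : ℕ) (P : Finset (Fin n)) 
    (hP : ∀ x ∈ P, (x : ℕ) < i) (hmin : ∀ j < i, withTail j P ∉ Γ) (k : ℕ) (hk : k < d) :
    Subsingleton (Ext (ModuleCat.of (MvPolynomial (Fin n) K)
      (MvPolynomial (Fin n) K ⧸ faceIdeal K (LowerSet.Iic ∅)))
      (ModuleCat.of _ (MvPolynomial (Fin n) K ⧸ faceIdeal K (Γ.initialPart i P))) k) := by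
  by_cases hPΓ : P ∉ Γ
  · rw [LowerSet.initialPart_eq_bot hPΓ]
    exact subsingleton_ext_faceIdeal_bot _ k
  rw [not_not] at hPΓ
  by_cases ht : withTail i P ∈ Γ
  · rw [LowerSet.initialPart_eq_Iic ht]
    exact subsingleton_ext_quotient_faceIdeal_Iic _ k
      (hk.trans_le (hd _ (hΓ.maximal_withTail ht hmin)))
  · have hi : i < n := by
      by_contra! h
      exact ht (by rwa [withTail_of_le h])
    have hPv : ∀ x ∈ P, x < ⟨i, hi⟩ := hP
    have hmin' : ∀ j < i + 1, withTail j P ∉ Γ := fun j hj ↦ by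
      rcases Nat.lt_succ_iff_lt_or_eq.1 hj with hj | rfl
      exacts [hmin j hj, ht]
    refine subsingleton_ext_faceIdeal_of_star_of_del ⟨i, hi⟩ _ k ?_ ?_
    · rw [LowerSet.faceStar_initialPart (v := ⟨i, hi⟩)]
      refine subsingleton_ext_initialPart hΓ hd _ _ ?_ (fun j hj ↦ ?_) k hk
      · intro x hx
        rcases Finset.mem_insert.1 hx with rfl | hx
        · exact Nat.lt_succ_self i
        · exact Nat.lt_succ_of_lt (hP x hx)
      · rw [withTail_insert (Nat.le_of_lt_succ hj)]
        exact hmin' j hj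
    · rw [LowerSet.faceDel_initialPart hPv]
      exact subsingleton_ext_initialPart hΓ hd _ _ (fun x hx ↦ Nat.lt_succ_of_lt (hP x hx)) hmin'
        k hk
  termination_by n - i

end Shifted

section StanleyDecomposition

variable {n : ℕ} {Γ : LowerSet (Finset (Fin n))}

/-- Every facet bounds the size of the Stanley spaces from above. -/
theorem StanleyPartN.le_card_of_maximal {m : ℕ} (h : StanleyPartN {a | a.support ∈ Γ} m)
    {F : Finset (Fin n)} (hF : Maximal (· ∈ Γ) F) : m ≤ F.card := by
  obtain ⟨ι, _, u, Z, hm, hsub, hcov⟩ := h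
  let M := (∑ i, ∑ j, u i j) + 1
  have hM : ∀ i j, u i j < M := fun i j ↦ Nat.lt_succ_of_le <|
    (Finset.single_le_sum (f := fun j ↦ u i j) (fun _ _ ↦ Nat.zero_le _) (Finset.mem_univ j)).trans
      (Finset.single_le_sum (f := fun i ↦ ∑ j, u i j) (fun _ _ ↦ Nat.zero_le _)
        (Finset.mem_univ i))
  have happly : ∀ j, (M • sqfreeExp F) j = if j ∈ F then M else 0 := fun j ↦ by
    simp [sqfreeExp_apply]
  have hsupp : (M • sqfreeExp F).support = F := by
    ext j
    rw [Finsupp.mem_support_iff, happly]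
    simp [M]
  obtain ⟨i, hi, -⟩ := hcov (M • sqfreeExp F) (by
    rw [Set.mem_ofPred_eq, hsupp]
    exact hF.prop)
  have hFZ : F ⊆ Z i := fun j hj ↦ by
    by_contra hjZ
    have := hi.2 j hjZ
    rw [happly, if_pos hj] at this
    exact (hM i j).ne' this
  have hmem : u i + sqfreeExp (Z i) ∈ cone (u i) (Z i) :=
    ⟨fun j ↦ by simp, fun j hj ↦ by simp [sqfreeExp_apply, hj]⟩
  have hZ : Z i ∈ Γ := by
    refine Γ.lower (fun j hj ↦ ?_) (hsub i hmem)
    simp [sqfreeExp_apply, hj]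
  exact (hm i).trans (Finset.card_le_card (hF.2 hZ hFZ))

theorem mem_cone_sqfreeExp_withTail {i : ℕ} {P : Finset (Fin n)} (hP : ∀ x ∈ P, (x : ℕ) < i)
    {a : Fin n →₀ ℕ} :
    a ∈ cone (sqfreeExp P) (withTail i P) ↔ P = a.support.filter fun x : Fin n ↦ (x : ℕ) < i := by
  simp only [cone, Set.mem_ofPred_eq, sqfreeExp_apply, mem_withTail, not_or, Finset.ext_iff,
    Finset.mem_filter, Finsupp.mem_support_iff]
  constructor
  · rintro ⟨h₁, h₂⟩ x
    have h₁ := h₁ x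
    have h₂ := h₂ x
    have hP := hP x
    grind
  · intro h
    refine ⟨fun j ↦ ?_, fun j hj ↦ ?_⟩
    · have h := h j
      grind
    · have h := h j
      grind

theorem withTail_filter_lt {i j : ℕ} (h : j ≤ i) (P : Finset (Fin n)) :
    withTail j (P.filter fun x : Fin n ↦ (x : ℕ) < i) = withTail j P := by
  ext x
  simp only [mem_withTail, Finset.mem_filter]
  grind

theorem IsShifted.stanleyPartN (hΓ : IsShifted Γ) {d : ℕ}
    (hd : ∀ F, Maximal (· ∈ Γ) F → d ≤ F.card) : StanleyPartN {a | a.support ∈ Γ} d := by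
  let ι := {p : Fin (n + 1) × Finset (Fin n) // (∀ x ∈ p.2, (x : ℕ) < p.1) ∧
    withTail p.1 p.2 ∈ Γ ∧ ∀ j < (p.1 : ℕ), withTail j p.2 ∉ Γ}
  refine ⟨ι, Fintype.ofFinite ι, fun p ↦ sqfreeExp p.1.2, fun p ↦ withTail p.1.1 p.1.2,
    fun p ↦ hd _ (hΓ.maximal_withTail p.2.2.1 p.2.2.2), fun p a ha ↦ ?_, fun a ha ↦ ?_⟩
  · rw [mem_cone_sqfreeExp_withTail p.2.1] at ha
    refine Γ.lower (fun x hx ↦ ?_) p.2.2.1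
    rw [mem_withTail, ha, Finset.mem_filter]
    grind
  · have hex : ∃ i, withTail i a.support ∈ Γ := ⟨n, by rwa [withTail_of_le le_rfl]⟩
    classical
    have hle : Nat.find hex ≤ n := Nat.find_min' hex (by rwa [withTail_of_le le_rfl])
    refine ⟨⟨(⟨Nat.find hex, by omega⟩, a.support.filter fun x : Fin n ↦ (x : ℕ) < Nat.find hex),
      fun x hx ↦ (Finset.mem_filter.1 hx).2, ?_, fun j hj ↦ ?_⟩, ?_, ?_⟩
    · rw [withTail_filter_lt le_rfl]
      exact Nat.find_spec hex
    · rw [withTail_filter_lt hj.le]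
      exact Nat.find_min hex hj
    · exact (mem_cone_sqfreeExp_withTail fun x hx ↦ (Finset.mem_filter.1 hx).2).2 rfl
    · rintro ⟨⟨i, P⟩, hP, hmem, hmin⟩ h
      dsimp only at hP hmem hmin h
      rw [mem_cone_sqfreeExp_withTail hP] at h
      subst h
      have hi : Nat.find hex = i := by
        rw [Nat.find_eq_iff]
        rw [withTail_filter_lt le_rfl] at hmem
        refine ⟨hmem, fun j hj hj' ↦ hmin j hj ?_⟩
        rwa [withTail_filter_lt hj.le]
      ext1
      simp only [hi]

end StanleyDecomposition

section Main

variable {K : Type} [Field K] {n : ℕ}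

theorem maxIdeal_eq_faceIdeal : maxIdeal K n = faceIdeal K (LowerSet.Iic ∅) := by
  ext f
  rw [maxIdeal, ← Set.image_univ, mem_ideal_span_X_image, mem_faceIdeal]
  refine forall₂_congr fun a _ ↦ ?_
  simp [Finsupp.ext_iff]

/-- The squarefree monomials outside `I`, as a complex of supports. -/
def nonMemComplex (I : Ideal (MvPolynomial (Fin n) K)) : LowerSet (Finset (Fin n)) where
  carrier := {G | monomial (sqfreeExp G) (1 : K) ∉ I}
  lower' G H h hG hH := hG <| I.mem_of_dvd (monomial_dvd_monomial.2 ⟨.inr fun j ↦ by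
    have := @h j
    simp only [sqfreeExp_apply]
    grind, one_dvd _⟩) hH

theorem mem_nonMemComplex {I : Ideal (MvPolynomial (Fin n) K)} {G : Finset (Fin n)} :
    G ∈ nonMemComplex I ↔ monomial (sqfreeExp G) (1 : K) ∉ I := Iff.rfl

theorem IsSqfreeMonomialIdeal.eq_faceIdeal {I : Ideal (MvPolynomial (Fin n) K)}
    (hI : IsSqfreeMonomialIdeal I) : I = faceIdeal K (nonMemComplex I) := by
  obtain ⟨B, hB, hIB⟩ := hI
  ext f
  simp only [mem_faceIdeal, mem_nonMemComplex, not_not, hIB, mem_ideal_span_monomial_image,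
    mem_support_iff, coeff_monomial, ite_ne_right_iff, ne_eq, one_ne_zero, not_false_eq_true,
    and_true, forall_eq']
  refine forall₂_congr fun a _ ↦ exists_congr fun b ↦ and_congr_right fun hb ↦ ?_
  simp only [Finsupp.le_def, sqfreeExp_apply, Finsupp.mem_support_iff]
  refine forall_congr' fun j ↦ ?_
  have := hB b hb j
  grind

theorem IsSqfreeStronglyStable.isShifted {I : Ideal (MvPolynomial (Fin n) K)}
    (hI : IsSqfreeStronglyStable I) : IsShifted (nonMemComplex I) := by
  intro G hG x hx w hw hxw hmem
  refine hG ?_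
  have hsq : IsSqfree (sqfreeExp (insert w (G.erase x))) := fun i ↦ by
    rw [sqfreeExp_apply]
    split_ifs <;> simp
  have hG' : sqfreeExp G = sqfreeExp (insert w (G.erase x)) + Finsupp.single x 1 -
      Finsupp.single w 1 := by
    ext j
    simp only [Finsupp.tsub_apply, Finsupp.add_apply, sqfreeExp_apply, Finsupp.single_apply,
      Finset.mem_insert, Finset.mem_erase]
    have := hxw.ne
    grind
  rw [hG']
  exact hI.2 _ hsq hmem w (by simp [sqfreeExp_apply]) x hxw (by simp [sqfreeExp_apply, hxw.ne])

theorem IsShifted.sdepthN_eq {Γ : LowerSet (Finset (Fin n))} (hΓ : IsShifted Γ)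
    {F : Finset (Fin n)} (hF : Maximal (· ∈ Γ) F)
    (hmin : ∀ G, Maximal (· ∈ Γ) G → F.card ≤ G.card) :
    sdepthN {a | a.support ∈ Γ} = F.card := by
  refine le_antisymm (sSup_le ?_) (le_sSup ⟨F.card, hΓ.stanleyPartN hmin, rfl⟩)
  rintro _ ⟨m, hm, rfl⟩
  exact_mod_cast hm.le_card_of_maximal hF

theorem IsShifted.mdepth_eq {Γ : LowerSet (Finset (Fin n))} (hΓ : IsShifted Γ)
    {F : Finset (Fin n)} (hF : Maximal (· ∈ Γ) F)
    (hmin : ∀ G, Maximal (· ∈ Γ) G → F.card ≤ G.card) :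
    mdepth K n (MvPolynomial (Fin n) K ⧸ faceIdeal K Γ) = F.card := by
  refine le_antisymm (sSup_le ?_) (le_sSup ?_)
  · rintro _ ⟨rs, hrs, hreg, rfl⟩
    rw [maxIdeal_eq_faceIdeal] at hrs
    have h := hreg.toIsWeaklyRegular.length_le_ringKrullDim_quotient rs hrs
      (isAssociatedPrime_faceIdeal_Iic (K := K) hF)
      (faceIdeal_anti (LowerSet.Iic_le.2 (Finset.empty_subset F)))
    rw [ringKrullDim_quotient_faceIdeal_Iic] at h
    exact_mod_cast h
  · have h := hΓ.subsingleton_ext_initialPart (K := K) hmin 0 ∅ (by simp) (by simp)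
    rw [LowerSet.initialPart_zero_empty] at h
    obtain ⟨rs, hlen, hmem, hreg⟩ := exists_isRegular_of_subsingleton_ext
      (Γ.lower (Finset.empty_subset F) hF.prop) F.card h
    exact ⟨rs, by rwa [maxIdeal_eq_faceIdeal], hreg, by rw [hlen]⟩

end Main

/-- Remark `sd_sqf_st_st`. Let `I ⊆ S = K[x_1,…,x_n]` be a (proper)
squarefree strongly stable monomial ideal. Then `sdepth_n(S/I) = depth(S/I)`. -/
theorem sdepthN_quotient_eq_depth_of_sqfreeStronglyStable {K : Type} [Field K] {n : ℕ}
    (I : Ideal (MvPolynomial (Fin n) K)) (hst : IsSqfreeStronglyStable I) (hI : I ≠ ⊤) :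
    sdepthN ((expSet I)ᶜ) = mdepth K n (MvPolynomial (Fin n) K ⧸ I) := by
  have hfin : {F | Maximal (· ∈ nonMemComplex I) F}.Finite := Set.toFinite _
  have hempty : ∅ ∈ nonMemComplex I := fun h ↦ hI ((Ideal.eq_top_iff_one I).2 (by
    have h₀ : sqfreeExp (∅ : Finset (Fin n)) = 0 := by ext; simp [sqfreeExp_apply]
    rwa [h₀] at h))
  obtain ⟨F₀, -, hF₀⟩ := (Set.toFinite {G | G ∈ nonMemComplex I}).exists_le_maximal hempty
  obtain ⟨F, hF, hmin⟩ := Set.exists_min_image _ Finset.card hfin ⟨F₀, hF₀⟩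
  have hexp : (expSet I)ᶜ = {a | a.support ∈ nonMemComplex I} := by
    ext a
    rw [Set.mem_compl_iff, expSet, Set.mem_ofPred_eq, hst.1.eq_faceIdeal, monomial_mem_faceIdeal,
      not_not, ← hst.1.eq_faceIdeal, Set.mem_ofPred_eq]
  rw [hexp, hst.isShifted.sdepthN_eq hF hmin, ← hst.isShifted.mdepth_eq (K := K) hF hmin,
    ← hst.1.eq_faceIdeal]
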